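/- Let (X,μ) and (Y,ν) be σ-finite measure spaces, let m₁ : X → (0,∞) and m₂ : Y → (0,∞) be measurable weights, let 1 ≤ p ≤ ∞ and let q be the conjugate exponent (1/p + 1/q = 1). Let k : X×Y → ℂ be measurable and set C := ess sup_{y∈Y} m₂(y) ‖k(·,y)·m₁⁻¹‖_{L^q(μ)}. If C < ∞, then for every f ∈ L^p_{m₁}(μ) the integral T_k f(y) = ∫_X k(x,y) f(x) dμ(x) converges absolutely for ν-almost every y, T_k f ∈ L^∞_{m₂}(ν), and ‖T_k f‖_{L^∞_{m₂}(ν)} ≤ C ‖f‖_{L^p_{m₁}(μ)}. Conversely, if T_k is bounded from L^p_{m₁}(μ) to L^∞_{m₂}(ν) with operator norm C′, then C ≤ C′. In particular, T_k is bounded from L^p_{m₁}(μ) to L^∞_{m₂}(ν) if and only if C < ∞, and in that case its operator norm equals C. -/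

import Mathlib

open MeasureTheory ENNReal Filter Topology

/-- Every section of a measurable set in a product lies in one countably generated σ-algebra. -/
theorem MeasurableSet.exists_countable_generating_sections {X Y : Type*} [MeasurableSpace X]
    [MeasurableSpace Y] {S : Set (X × Y)} (hS : MeasurableSet S) :
    ∃ 𝒢 : Set (Set X), 𝒢.Countable ∧ (∀ A ∈ 𝒢, MeasurableSet A) ∧
      ∀ y, MeasurableSet[MeasurableSpace.generateFrom 𝒢] {x | (x, y) ∈ S} := by
  induction S, hS using MeasurableSpace.induction_on_inter generateFrom_prod.symm isPiSystem_prod with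
  | empty => exact ⟨∅, by simp, by simp, fun y => by simp⟩
  | basic t ht =>
    obtain ⟨A, hA, B, hB, rfl⟩ := ht
    refine ⟨{A}, by simp, by simpa using hA, fun y => ?_⟩
    by_cases hy : y ∈ B
    · simpa [hy] using MeasurableSpace.measurableSet_generateFrom (Set.mem_singleton A)
    · simp [hy]
  | compl t _ ih =>
    obtain ⟨𝒢, hc, hm, h⟩ := ih
    exact ⟨𝒢, hc, hm, fun y => MeasurableSet.compl (h y)⟩
  | iUnion f _ _ ih =>
    choose 𝒢 hc hm h using ih
    refine ⟨⋃ n, 𝒢 n, Set.countable_iUnion hc, ?_, fun y => ?_⟩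
    · intro A hA
      obtain ⟨n, hn⟩ := Set.mem_iUnion.1 hA
      exact hm n A hn
    · have : {x | (x, y) ∈ ⋃ n, f n} = ⋃ n, {x | (x, y) ∈ f n} := by ext; simp
      rw [this]
      exact MeasurableSet.iUnion fun n =>
        MeasurableSpace.generateFrom_mono (Set.subset_iUnion 𝒢 n) _ (h n y)

/-- Every section of a jointly measurable function into a second countable space is measurable
with respect to one countably generated σ-algebra. -/
theorem Measurable.exists_seq_generating_sections {X Y Z : Type*} [MeasurableSpace X]
    [MeasurableSpace Y] [TopologicalSpace Z] [SecondCountableTopology Z] [MeasurableSpace Z]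
    [BorelSpace Z] {k : X × Y → Z} (hk : Measurable k) :
    ∃ s : ℕ → Set X, (∀ n, MeasurableSet (s n)) ∧
      ∀ y, Measurable[MeasurableSpace.generateFrom (Set.range s)] fun x => k (x, y) := by
  have hB := TopologicalSpace.countable_countableBasis Z
  have key : ∀ U : TopologicalSpace.countableBasis Z, ∃ 𝒢 : Set (Set X), 𝒢.Countable ∧
      (∀ A ∈ 𝒢, MeasurableSet A) ∧
      ∀ y, MeasurableSet[MeasurableSpace.generateFrom 𝒢] {x | (x, y) ∈ k ⁻¹' U} := fun U =>
    (hk (TopologicalSpace.isOpen_of_mem_countableBasis U.2).measurableSet)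
      |>.exists_countable_generating_sections
  choose 𝒢 hc hm h using key
  have := hB.to_subtype
  obtain ⟨s, hs⟩ := ((Set.countable_iUnion hc).insert ∅).exists_eq_range (Set.insert_nonempty _ _)
  refine ⟨s, fun n => ?_, fun y => ?_⟩
  · have hn : s n ∈ insert ∅ (⋃ U, 𝒢 U) := hs ▸ Set.mem_range_self n
    rcases hn with hn | hn
    · simp [hn]
    · obtain ⟨U, hU⟩ := Set.mem_iUnion.1 hn
      exact hm U _ hU
  · rw [← hs]
    have hZ := (BorelSpace.measurable_eq (α := Z)).trans
      (TopologicalSpace.isBasis_countableBasis Z).borel_eq_generateFrom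
    have := @measurable_generateFrom X Z (MeasurableSpace.generateFrom (insert ∅ (⋃ U, 𝒢 U)))
      (TopologicalSpace.countableBasis Z) (fun x => k (x, y)) fun U hU =>
        MeasurableSpace.generateFrom_mono
          ((Set.subset_iUnion 𝒢 ⟨U, hU⟩).trans (Set.subset_insert _ _)) _ (h ⟨U, hU⟩ y)
    rwa [← hZ] at this

/-- Lévy's upward theorem for complex-valued functions. -/
theorem MeasureTheory.Integrable.tendsto_ae_condExp_complex {X : Type*} {m0 : MeasurableSpace X}
    {μ : Measure X} [IsFiniteMeasure μ] {ℱ : Filtration ℕ m0} {h : X → ℂ} (hint : Integrable h μ)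
    (hh : StronglyMeasurable[⨆ n, ℱ n] h) :
    ∀ᵐ x ∂μ, Tendsto (fun n => (μ[h | ℱ n]) x) atTop (𝓝 (h x)) := by
  have hre := Integrable.tendsto_ae_condExp (ℱ := ℱ) (Complex.reCLM.integrable_comp hint)
    (Complex.continuous_re.comp_stronglyMeasurable hh)
  have him := Integrable.tendsto_ae_condExp (ℱ := ℱ) (Complex.imCLM.integrable_comp hint)
    (Complex.continuous_im.comp_stronglyMeasurable hh)
  have cre : ∀ᵐ x ∂μ, ∀ n, _ := ae_all_iff.2 fun n =>
    Complex.reCLM.comp_condExp_comm (m := ℱ n) hint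
  have cim : ∀ᵐ x ∂μ, ∀ n, _ := ae_all_iff.2 fun n =>
    Complex.imCLM.comp_condExp_comm (m := ℱ n) hint
  filter_upwards [hre, him, cre, cim] with x h1 h2 h3 h4
  have h1' : Tendsto (fun n => ((μ[h | ℱ n]) x).re) atTop (𝓝 (h x).re) :=
    h1.congr fun n => (h3 n).symm
  have h2' : Tendsto (fun n => ((μ[h | ℱ n]) x).im) atTop (𝓝 (h x).im) :=
    h2.congr fun n => (h4 n).symm
  have := ((Complex.continuous_ofReal.tendsto _).comp h1').add
    (((Complex.continuous_ofReal.tendsto _).comp h2').mul_const Complex.I)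
  simpa [Function.comp_def, Complex.re_add_im] using this

/-- A countable set of complex numbers approximating every number from inside. -/
theorem exists_countable_approx_norm_le : ∃ S : Set ℂ, S.Countable ∧
    ∀ z : ℂ, ∀ ε > 0, ∃ w ∈ S, ‖w‖ ≤ ‖z‖ ∧ ‖w - z‖ < ε := by
  refine ⟨insert 0 (Set.range (TopologicalSpace.denseSeq ℂ)),
    (Set.countable_range _).insert 0, fun z ε hε => ?_⟩
  rcases eq_or_ne z 0 with rfl | hz
  · exact ⟨0, by simp, by simp, by simpa⟩
  have hz' : 0 < ‖z‖ := norm_pos_iff.2 hz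
  have hcl : z ∈ closure (Metric.ball (0 : ℂ) ‖z‖) := by
    rw [closure_ball _ hz'.ne']; simp
  obtain ⟨v, hv, hvz⟩ := Metric.mem_closure_iff.1 hcl ε hε
  obtain ⟨w, hw⟩ := (TopologicalSpace.denseRange_denseSeq ℂ).exists_mem_open
    (Metric.isOpen_ball.inter Metric.isOpen_ball)
    ⟨v, hv, show v ∈ Metric.ball z ε from Metric.mem_ball'.2 hvz⟩
  refine ⟨_, Set.mem_insert_of_mem _ ⟨w, rfl⟩, ?_, ?_⟩
  · simpa using (Metric.mem_ball.1 hw.1).le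
  · simpa [dist_eq_norm] using hw.2

/-- A bound on integrals against bounded functions upgrades to a bound with absolute values. -/
theorem lintegral_enorm_mul_le_of_norm_integral_le {X : Type*} {m m0 : MeasurableSpace X}
    {μ : Measure X} (hm : m ≤ m0) [IsFiniteMeasure μ] {p C : ℝ≥0∞} {h : X → ℂ}
    (hh : StronglyMeasurable[m] h) {M : NNReal} (hM : ∀ x, ‖h x‖₊ ≤ M)
    (H : ∀ g : X → ℂ, StronglyMeasurable[m] g → (∃ R : ℝ, ∀ x, ‖g x‖ ≤ R) →
      ‖∫ x, h x * g x ∂μ‖ₑ ≤ C * eLpNorm g p μ)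
    {φ : X → NNReal} (hφ : Measurable[m] φ) {R : NNReal} (hR : ∀ x, φ x ≤ R) :
    ∫⁻ x, ‖h x‖ₑ * φ x ∂μ ≤ C * eLpNorm (fun x => (φ x : ℝ)) p μ := by
  set g : X → ℂ := fun x => (starRingEnd ℂ (h x) / (‖h x‖ : ℂ)) * ((φ x : ℝ) : ℂ) with hg
  have hhm : Measurable[m] h := hh.measurable
  have hgm : Measurable[m] g := by
    have h1 : Measurable[m] fun x => starRingEnd ℂ (h x) :=
      Complex.continuous_conj.measurable.comp hhm
    have h2 : Measurable[m] fun x => ((‖h x‖ : ℝ) : ℂ) := 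
      Complex.measurable_ofReal.comp (measurable_norm.comp hhm)
    have h3 : Measurable[m] fun x => ((φ x : ℝ) : ℂ) :=
      Complex.measurable_ofReal.comp (NNReal.continuous_coe.measurable.comp hφ)
    exact (h1.div h2).mul h3
  have hgn : ∀ x, ‖g x‖ ≤ φ x := by
    intro x
    simp only [hg, norm_mul, norm_div, RCLike.norm_conj, Complex.norm_real, norm_norm]
    have := div_self_le_one ‖h x‖
    simpa using mul_le_of_le_one_left (φ x).2 this
  have hprod : ∀ x, h x * g x = ((‖h x‖ * φ x : ℝ) : ℂ) := by
    intro x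
    rcases eq_or_ne (h x) 0 with h0 | h0
    · simp [hg, h0]
    · have : (‖h x‖ : ℂ) ≠ 0 := by simpa using h0
      have h2 := Complex.mul_conj' (h x)
      simp only [hg]
      push_cast
      rw [← mul_assoc, mul_div_assoc', h2]
      field_simp
  have hint : Integrable (fun x => ‖h x‖ * φ x : X → ℝ) μ := by
    refine Integrable.of_bound (C := M * R) ?_ (ae_of_all _ fun x => ?_)
    · exact ((measurable_norm.comp (hhm.mono hm le_rfl)).mul
        (NNReal.continuous_coe.measurable.comp (hφ.mono hm le_rfl))).aestronglyMeasurable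
    · rw [Real.norm_of_nonneg (by positivity)]
      have h1 : ‖h x‖ ≤ M := hM x
      have h2 : (φ x : ℝ) ≤ R := hR x
      gcongr
  calc ∫⁻ x, ‖h x‖ₑ * φ x ∂μ = ‖∫ x, h x * g x ∂μ‖ₑ := by
        simp_rw [hprod]
        rw [integral_complex_ofReal, ← ofReal_norm, Complex.norm_real,
          Real.norm_of_nonneg (integral_nonneg fun x => by positivity),
          ofReal_integral_eq_lintegral_ofReal hint (ae_of_all _ fun x => by positivity)]
        refine lintegral_congr fun x => ?_
        rw [ENNReal.ofReal_mul (norm_nonneg _), ofReal_norm, ENNReal.ofReal_coe_nnreal]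
    _ ≤ C * eLpNorm g p μ := H g hgm.stronglyMeasurable
        ⟨R, fun x => (hgn x).trans (hR x)⟩
    _ ≤ _ := by
        gcongr
        exact eLpNorm_mono fun x => by simpa using hgn x

/-- Converse of Hölder's inequality for bounded functions on a finite measure space. -/
theorem eLpNorm_le_of_forall_norm_integral_mul_le {X : Type*} {m m0 : MeasurableSpace X}
    {μ : Measure X} (hm : m ≤ m0) [IsFiniteMeasure μ] {p q C : ℝ≥0∞}
    [hpq : ENNReal.HolderConjugate p q] {h : X → ℂ}
    (hh : StronglyMeasurable[m] h) {M : NNReal} (hM : ∀ x, ‖h x‖₊ ≤ M)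
    (H : ∀ g : X → ℂ, StronglyMeasurable[m] g → (∃ R : ℝ, ∀ x, ‖g x‖ ≤ R) →
      ‖∫ x, h x * g x ∂μ‖ₑ ≤ C * eLpNorm g p μ) :
    eLpNorm h q μ ≤ C := by
  rcases eq_or_ne C ∞ with rfl | hC
  · exact le_top
  have hhm : Measurable[m] h := hh.measurable
  have key := fun (φ : X → NNReal) (hφ : Measurable[m] φ) (R : NNReal) (hR : ∀ x, φ x ≤ R) =>
    lintegral_enorm_mul_le_of_norm_integral_le hm hh hM H hφ hR
  rcases eq_or_ne q ∞ with rfl | hq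
  · obtain rfl : p = 1 := (ENNReal.HolderConjugate.eq_top_iff_eq_one ∞ p).1 rfl
    have hA : MeasurableSet[m] {x | C < ‖h x‖ₑ} := (measurable_enorm.comp hhm) measurableSet_Ioi
    set A := {x | C < ‖h x‖ₑ}
    have hμA : μ A = 0 := by
      by_contra h0
      have h1 := key (A.indicator 1) (Measurable.indicator (@measurable_const _ _ _ m 1) hA) 1 fun x =>
        Set.indicator_le_self' (fun _ _ => zero_le_one) x
      have h2 : C * eLpNorm (fun x => ((A.indicator 1 x : NNReal) : ℝ)) 1 μ = C * μ A := by
        rw [eLpNorm_one_eq_lintegral_enorm, ← lintegral_indicator_one (hm _ hA)]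
        congr 2 with x
        by_cases hx : x ∈ A <;> simp [hx]
      have h3 : ∫⁻ x, ‖h x‖ₑ * ((A.indicator 1 x : NNReal) : ℝ≥0∞) ∂μ = ∫⁻ x in A, ‖h x‖ₑ ∂μ := by
        rw [← lintegral_indicator (hm _ hA)]
        congr 1 with x
        by_cases hx : x ∈ A <;> simp [hx]
      rw [h2, h3] at h1
      have h4 : ∫⁻ _ in A, C ∂μ < ∫⁻ x in A, ‖h x‖ₑ ∂μ :=
        setLIntegral_strict_mono (hm _ hA) h0 (measurable_enorm.comp (hhm.mono hm le_rfl))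
          (by simpa using ENNReal.mul_ne_top hC (measure_ne_top μ A)) (ae_of_all _ fun x hx => hx)
      rw [setLIntegral_const] at h4
      exact absurd h1 (not_le.2 h4)
    rw [eLpNorm_exponent_top]
    refine essSup_le_of_ae_le C ?_
    filter_upwards [measure_eq_zero_iff_ae_notMem.1 hμA] with x hx
    exact not_lt.1 hx
  rcases eq_or_ne p ∞ with rfl | hp
  · obtain rfl : q = 1 := (ENNReal.HolderConjugate.eq_top_iff_eq_one ∞ q).1 rfl
    have h1 := key 1 (@measurable_const _ _ _ m 1) 1 fun x => le_rfl
    rw [eLpNorm_one_eq_lintegral_enorm]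
    calc ∫⁻ x, ‖h x‖ₑ ∂μ ≤ C * eLpNorm (fun _ => (1 : ℝ)) ∞ μ := by simpa using h1
      _ ≤ C * 1 := by
        gcongr
        refine (eLpNormEssSup_le_of_ae_bound (C := 1) (by simp)).trans (by simp)
      _ = C := mul_one C
  have hp0 := ENNReal.HolderConjugate.ne_zero p q
  have hq0 := ENNReal.HolderConjugate.ne_zero q p
  have hr : q.toReal.HolderConjugate p.toReal := by
    have := ENNReal.HolderTriple.toReal (p := q) (q := p) (r := 1) (ENNReal.toReal_pos hq0 hq)
      (ENNReal.toReal_pos hp0 hp)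
    simpa using this
  set I := ∫⁻ x, ‖h x‖ₑ ^ q.toReal ∂μ with hI
  have hItop : I ≠ ∞ := by
    refine (lt_of_le_of_lt (lintegral_mono (g := fun _ => (M : ℝ≥0∞) ^ q.toReal) fun x => ?_) ?_).ne
    · exact ENNReal.rpow_le_rpow (by simpa [enorm] using hM x) hr.nonneg
    · rw [lintegral_const]
      exact ENNReal.mul_lt_top (ENNReal.rpow_lt_top_of_nonneg hr.nonneg (by simp))
        (measure_lt_top μ _)
  have h1 := key (fun x => ‖h x‖₊ ^ (q.toReal - 1))
    ((measurable_nnnorm.comp hhm).pow_const _) (M ^ (q.toReal - 1))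
    fun x => NNReal.rpow_le_rpow (hM x) hr.sub_one_pos.le
  have h2 : ∫⁻ x, ‖h x‖ₑ * ((‖h x‖₊ ^ (q.toReal - 1) : NNReal) : ℝ≥0∞) ∂μ = I := by
    refine lintegral_congr fun x => ?_
    rw [ENNReal.coe_rpow_of_nonneg _ hr.sub_one_pos.le]
    change ‖h x‖ₑ * ‖h x‖ₑ ^ (q.toReal - 1) = _
    conv_lhs => rw [← ENNReal.rpow_one ‖h x‖ₑ, ← ENNReal.rpow_mul, one_mul]
    rw [← ENNReal.rpow_add_of_nonneg _ _ zero_le_one hr.sub_one_pos.le]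
    congr 1; ring
  have h3 : eLpNorm (fun x => ((‖h x‖₊ ^ (q.toReal - 1) : NNReal) : ℝ)) p μ
      = I ^ (p.toReal)⁻¹ := by
    rw [eLpNorm_eq_lintegral_rpow_enorm_toReal hp0 hp, one_div]
    congr 1
    refine lintegral_congr fun x => ?_
    have : ‖((‖h x‖₊ ^ (q.toReal - 1) : NNReal) : ℝ)‖ₑ = ‖h x‖ₑ ^ (q.toReal - 1) := by
      rw [Real.enorm_of_nonneg (NNReal.coe_nonneg _), ENNReal.ofReal_coe_nnreal,
        ENNReal.coe_rpow_of_nonneg _ hr.sub_one_pos.le, enorm_eq_nnnorm]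
    rw [this, ← ENNReal.rpow_mul, hr.sub_one_mul_conj]
  rw [h2, h3] at h1
  rw [eLpNorm_eq_lintegral_rpow_enorm_toReal hq0 hq, ← hI, one_div]
  rcases eq_or_ne I 0 with h0 | h0
  · rw [h0, ENNReal.zero_rpow_of_pos hr.inv_pos]; exact zero_le
  have hJ0 : I ^ (p.toReal)⁻¹ ≠ 0 := (ENNReal.rpow_pos (pos_iff_ne_zero.2 h0) hItop).ne'
  have hJt : I ^ (p.toReal)⁻¹ ≠ ∞ := ENNReal.rpow_ne_top_of_nonneg hr.symm.inv_nonneg hItop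
  refine (ENNReal.mul_le_mul_iff_left hJ0 hJt).1 ?_
  rwa [← ENNReal.rpow_add _ _ h0 hItop, hr.inv_add_inv_eq_one, ENNReal.rpow_one]

/-- An integral bound tested on functions with values in an inner-approximating set extends to all
values. -/
theorem enorm_integral_mul_comp_le_of_approx {X ι : Type*} [MeasurableSpace X] [Finite ι]
    [MeasurableSpace ι] [DiscreteMeasurableSpace ι] {μ : Measure X} {p C : ℝ≥0∞} {S : Set ℂ}
    (hS : ∀ z : ℂ, ∀ ε > 0, ∃ w ∈ S, ‖w‖ ≤ ‖z‖ ∧ ‖w - z‖ < ε) {h : X → ℂ} (hint : Integrable h μ)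
    {π : X → ι} (hπ : Measurable π)
    (H : ∀ c : ι → S, ‖∫ x, h x * c (π x) ∂μ‖ₑ ≤ C * eLpNorm (fun x => (c (π x) : ℂ)) p μ)
    (c : ι → ℂ) :
    ‖∫ x, h x * c (π x) ∂μ‖ₑ ≤ C * eLpNorm (fun x => c (π x)) p μ := by
  choose w hwS hw hwc using fun (j : ℕ) (i : ι) => hS (c i) (1 / ((j : ℝ) + 1)) (by positivity)
  have hlim : ∀ i, Tendsto (fun j => w j i) atTop (𝓝 (c i)) := fun i => by
    rw [tendsto_iff_norm_sub_tendsto_zero]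
    exact squeeze_zero (fun _ => norm_nonneg _) (fun j => (hwc j i).le)
      tendsto_one_div_add_atTop_nhds_zero_nat
  obtain ⟨R, hR⟩ := (Set.finite_range fun i => ‖c i‖).bddAbove
  have hT : Tendsto (fun j => ∫ x, h x * w j (π x) ∂μ) atTop (𝓝 (∫ x, h x * c (π x) ∂μ)) := by
    refine tendsto_integral_of_dominated_convergence (fun x => ‖h x‖ * R) (fun j => ?_)
      (hint.norm.mul_const R) (fun j => ae_of_all _ fun x => ?_)
      (ae_of_all _ fun x => (hlim (π x)).const_mul (h x))
    · exact hint.1.mul ((Measurable.of_discrete (f := w j)).comp hπ).aestronglyMeasurable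
    · rw [norm_mul]
      gcongr
      exact (hw j _).trans (hR ⟨π x, rfl⟩)
  refine le_of_tendsto' ((continuous_enorm.tendsto _).comp hT) fun j => ?_
  refine (H fun i => ⟨w j i, hwS j i⟩).trans ?_
  gcongr
  exact eLpNorm_mono fun x => hw j (π x)

/-- The finite filtration generated by a sequence of sets. -/
def MeasureTheory.Filtration.ofMeasurableSets {X : Type*} {m0 : MeasurableSpace X} (s : ℕ → Set X)
    (hs : ∀ n, MeasurableSet (s n)) : Filtration ℕ m0 where
  seq n := MeasurableSpace.comap (fun x (i : Fin n) => x ∈ s i) inferInstance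
  mono' n k hnk := by
    rw [← measurable_iff_comap_le]
    refine @measurable_pi_lambda _ _ _ (MeasurableSpace.comap _ _) _ _ fun i => ?_
    exact (measurable_pi_apply (Fin.castLE hnk i)).comp
      (comap_measurable fun x (i : Fin k) => x ∈ s i)
  le' n := by
    rw [← measurable_iff_comap_le]
    exact measurable_pi_lambda _ fun i => measurableSet_setOfPred.1 (hs i)

theorem MeasureTheory.Filtration.generateFrom_le_iSup_ofMeasurableSets {X : Type*} {m0 : MeasurableSpace X}
    (s : ℕ → Set X) (hs : ∀ n, MeasurableSet (s n)) :
    MeasurableSpace.generateFrom (Set.range s) ≤ ⨆ n, Filtration.ofMeasurableSets s hs n := by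
  refine MeasurableSpace.generateFrom_le ?_
  rintro _ ⟨n, rfl⟩
  refine le_iSup (fun n => (Filtration.ofMeasurableSets s hs n : MeasurableSpace X)) (n + 1) _ ?_
  refine (@measurableSet_setOfPred _ (Filtration.ofMeasurableSets s hs (n + 1)) _).2 ?_
  exact (measurable_pi_apply (Fin.last n)).comp
    (comap_measurable fun x (i : Fin (n + 1)) => x ∈ s i)

/-- An `L^q` bound follows from testing against functions of finitely many generating sets. -/
theorem eLpNorm_le_of_forall_finite_test {X : Type*} {m0 : MeasurableSpace X}
    {μ : Measure X} [IsFiniteMeasure μ] {p q C : ℝ≥0∞} [hpq : ENNReal.HolderConjugate p q]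
    {s : ℕ → Set X} (hs : ∀ n, MeasurableSet (s n)) {h : X → ℂ} (hint : Integrable h μ)
    (hh : Measurable[MeasurableSpace.generateFrom (Set.range s)] h)
    (H : ∀ (n : ℕ) (c : (Fin n → Prop) → ℂ), ‖∫ x, h x * c (fun i => x ∈ s i) ∂μ‖ₑ
      ≤ C * eLpNorm (fun x => c (fun i => x ∈ s i)) p μ) :
    eLpNorm h q μ ≤ C := by
  set ℱ := Filtration.ofMeasurableSets s hs
  have hhs : StronglyMeasurable[⨆ n, ℱ n] h :=
    (hh.mono (Filtration.generateFrom_le_iSup_ofMeasurableSets s hs) le_rfl).stronglyMeasurable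
  have hlim := hint.tendsto_ae_condExp_complex hhs
  refine Lp.eLpNorm_le_of_ae_tendsto (Eventually.of_forall fun n => ?_)
    (fun n => integrable_condExp.1) hlim
  have hfac : ∀ g : X → ℂ, StronglyMeasurable[ℱ n] g →
      ∃ c : (Fin n → Prop) → ℂ, g = fun x => c (fun i => x ∈ s i) := fun g hg => by
    obtain ⟨c, -, hc⟩ := hg.measurable.exists_eq_measurable_comp
    exact ⟨c, hc⟩
  obtain ⟨b, hb⟩ := hfac _ (stronglyMeasurable_condExp (f := h) (μ := μ))
  obtain ⟨M, hM⟩ := (Set.finite_range fun i => ‖b i‖₊).bddAbove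
  refine eLpNorm_le_of_forall_norm_integral_mul_le (p := p) (ℱ.le n) stronglyMeasurable_condExp
    (M := M) (fun x => ?_) fun g hg ⟨R, hR⟩ => ?_
  · rw [hb]; exact hM ⟨_, rfl⟩
  obtain ⟨c, rfl⟩ := hfac g hg
  convert H n c using 2
  have hpull := condExp_bilin_of_stronglyMeasurable_right (ContinuousLinearMap.mul ℝ ℂ) hg
    (hint.mul_bdd (c := R) (hg.mono (ℱ.le n)).aestronglyMeasurable (ae_of_all _ hR)) hint
  exact (integral_congr_ae hpull).symm.trans (integral_condExp (ℱ.le n))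

/-- On a finite measure space, a kernel whose integrals against every bounded function `f` are
almost everywhere at most `C ‖f‖_p` has almost all its sections in the `L^q` ball of radius `C`. -/
theorem ae_eLpNorm_section_le {X Y : Type*} [MeasurableSpace X] [MeasurableSpace Y]
    {μ : Measure X} {ν : Measure Y} [IsFiniteMeasure μ] {p q C : ℝ≥0∞}
    [hpq : ENNReal.HolderConjugate p q] {K : X × Y → ℂ} (hK : Measurable K)
    (H : ∀ f : X → ℂ, Measurable f → (∃ R : ℝ, ∀ x, ‖f x‖ ≤ R) →
      (∀ᵐ y ∂ν, Integrable (fun x => K (x, y) * f x) μ) ∧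
      ∀ᵐ y ∂ν, ‖∫ x, K (x, y) * f x ∂μ‖ₑ ≤ C * eLpNorm f p μ) :
    ∀ᵐ y ∂ν, eLpNorm (fun x => K (x, y)) q μ ≤ C := by
  obtain ⟨s, hs, hsec⟩ := hK.exists_seq_generating_sections
  obtain ⟨S, hSc, hS⟩ := exists_countable_approx_norm_le
  have := hSc.to_subtype
  have hπ : ∀ n, Measurable fun x (i : Fin n) => x ∈ s i := fun n =>
    measurable_pi_lambda _ fun i => measurableSet_setOfPred.1 (hs i)
  have htest : ∀ᵐ y ∂ν, ∀ (n : ℕ) (c : (Fin n → Prop) → S),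
      ‖∫ x, K (x, y) * c (fun i => x ∈ s i) ∂μ‖ₑ
        ≤ C * eLpNorm (fun x => (c (fun i => x ∈ s i) : ℂ)) p μ := by
    refine ae_all_iff.2 fun n => ae_all_iff.2 fun c => (H _ ?_ ?_).2
    · exact (Measurable.of_discrete (f := fun i => (c i : ℂ))).comp (hπ n)
    · obtain ⟨R, hR⟩ := (Set.finite_range fun i => ‖(c i : ℂ)‖).bddAbove
      exact ⟨R, fun x => hR ⟨_, rfl⟩⟩
  have hint : ∀ᵐ y ∂ν, Integrable (fun x => K (x, y)) μ := by
    simpa using (H (fun _ => 1) measurable_const ⟨1, by simp⟩).1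
  filter_upwards [htest, hint] with y hy hyint
  exact eLpNorm_le_of_forall_finite_test (p := p) hs hyint (hsec y) fun n c =>
    enorm_integral_mul_comp_le_of_approx hS hyint (hπ n) (hy n) c

/-- **Schur test, `L^p_{m₁} → L^∞_{m₂}` version.**
Let `(X,μ)`, `(Y,ν)` be σ-finite measure spaces, `m₁, m₂` measurable positive weights,
`1 ≤ p ≤ ∞` with conjugate exponent `q` (`1/p + 1/q = 1`), `k` a measurable kernel, and
`C := ess sup_y m₂(y) ‖k(·,y) m₁⁻¹‖_{L^q(μ)}`.
If `C < ∞` then for every `f ∈ L^p_{m₁}(μ)` the integral `T_k f(y) = ∫ k(x,y) f(x) dμ(x)`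
converges absolutely for ν-a.e. `y`, `T_k f ∈ L^∞_{m₂}(ν)` and
`‖T_k f‖_{L^∞_{m₂}} ≤ C ‖f‖_{L^p_{m₁}}`.  Conversely any admissible bound `C'` satisfies
`C ≤ C'`.  In particular `T_k` is bounded iff `C < ∞`, with operator norm `C`. -/
theorem schur_test_Lp_to_Linfty
    {X Y : Type*} [MeasurableSpace X] [MeasurableSpace Y]
    (μ : Measure X) (ν : Measure Y) [SigmaFinite μ] [SigmaFinite ν]
    (m₁ : X → ℝ) (m₂ : Y → ℝ)
    (hm₁ : Measurable m₁) (hm₂ : Measurable m₂)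
    (hm₁pos : ∀ x, 0 < m₁ x) (hm₂pos : ∀ y, 0 < m₂ y)
    (p q : ℝ≥0∞) (hp : 1 ≤ p) (hpq : 1 / p + 1 / q = 1)
    (k : X × Y → ℂ) (hk : Measurable k)
    (C : ℝ≥0∞)
    (hC : C = essSup (fun y =>
      ENNReal.ofReal (m₂ y) * eLpNorm (fun x => (m₁ x)⁻¹ • k (x, y)) q μ) ν) :
    -- if `C < ∞`, then `T_k` maps `L^p_{m₁}(μ)` boundedly into `L^∞_{m₂}(ν)` with norm `≤ C`
    (C < ⊤ → ∀ f : X → ℂ, AEStronglyMeasurable f μ →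
        eLpNorm (fun x => m₁ x • f x) p μ < ⊤ →
        (∀ᵐ y ∂ν, Integrable (fun x => k (x, y) * f x) μ) ∧
        eLpNorm (fun y => m₂ y • ∫ x, k (x, y) * f x ∂μ) ⊤ ν
          ≤ C * eLpNorm (fun x => m₁ x • f x) p μ)
      ∧
    -- conversely, any admissible bound `C'` dominates `C`
    (∀ C' : ℝ≥0∞,
        (∀ f : X → ℂ, AEStronglyMeasurable f μ →
          eLpNorm (fun x => m₁ x • f x) p μ < ⊤ →
          (∀ᵐ y ∂ν, Integrable (fun x => k (x, y) * f x) μ) ∧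
          eLpNorm (fun y => m₂ y • ∫ x, k (x, y) * f x ∂μ) ⊤ ν
            ≤ C' * eLpNorm (fun x => m₁ x • f x) p μ) →
        C ≤ C')
      ∧
    -- in particular: boundedness holds iff `C < ∞`
    ((∃ C' : ℝ≥0∞, C' < ⊤ ∧
        ∀ f : X → ℂ, AEStronglyMeasurable f μ →
          eLpNorm (fun x => m₁ x • f x) p μ < ⊤ →
          (∀ᵐ y ∂ν, Integrable (fun x => k (x, y) * f x) μ) ∧
          eLpNorm (fun y => m₂ y • ∫ x, k (x, y) * f x ∂μ) ⊤ ν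
            ≤ C' * eLpNorm (fun x => m₁ x • f x) p μ) ↔ C < ⊤) := by
  have hconj : ENNReal.HolderConjugate p q :=
    ENNReal.holderConjugate_iff.2 (by simpa only [one_div] using hpq)
  have upper : C < ⊤ → ∀ f : X → ℂ, AEStronglyMeasurable f μ →
      eLpNorm (fun x => m₁ x • f x) p μ < ⊤ →
      (∀ᵐ y ∂ν, Integrable (fun x => k (x, y) * f x) μ) ∧
      eLpNorm (fun y => m₂ y • ∫ x, k (x, y) * f x ∂μ) ⊤ ν
        ≤ C * eLpNorm (fun x => m₁ x • f x) p μ := by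
    intro hCtop f hf hfp
    have hbound : ∀ᵐ y ∂ν,
        ENNReal.ofReal (m₂ y) * eLpNorm (fun x => (m₁ x)⁻¹ • k (x, y)) q μ ≤ C :=
      hC ▸ ENNReal.ae_le_essSup _
    have hprod : ∀ y, (fun x => k (x, y) * f x)
        = (fun x => (m₁ x)⁻¹ • k (x, y)) • fun x => m₁ x • f x := fun y => by
      ext x
      have : (m₁ x : ℂ) ≠ 0 := by exact_mod_cast (hm₁pos x).ne'
      simp only [Pi.smul_apply', smul_eq_mul, Complex.real_smul, Complex.ofReal_inv]
      field_simp
    have hkm : ∀ y, AEStronglyMeasurable (fun x => (m₁ x)⁻¹ • k (x, y)) μ := fun y =>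
      (hm₁.inv.smul (hk.comp measurable_prodMk_right)).aestronglyMeasurable
    have hfm : AEStronglyMeasurable (fun x => m₁ x • f x) μ :=
      hm₁.aestronglyMeasurable.smul hf
    have hholder : ∀ y, eLpNorm (fun x => k (x, y) * f x) 1 μ
        ≤ eLpNorm (fun x => (m₁ x)⁻¹ • k (x, y)) q μ * eLpNorm (fun x => m₁ x • f x) p μ :=
      fun y => by
        rw [hprod]
        exact eLpNorm_smul_le_mul_eLpNorm hfm (hkm y)
    refine ⟨?_, ?_⟩
    · filter_upwards [hbound] with y hy
      have hm₂0 : ENNReal.ofReal (m₂ y) ≠ 0 := by simpa using hm₂pos y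
      have hfin : eLpNorm (fun x => (m₁ x)⁻¹ • k (x, y)) q μ < ⊤ :=
        ENNReal.lt_top_of_mul_ne_top_right (hy.trans_lt hCtop).ne hm₂0
      refine memLp_one_iff_integrable.1 ⟨?_, (hholder y).trans_lt (ENNReal.mul_lt_top hfin hfp)⟩
      exact (hk.comp measurable_prodMk_right).aestronglyMeasurable.mul hf
    · rw [eLpNorm_exponent_top]
      refine essSup_le_of_ae_le _ ?_
      filter_upwards [hbound] with y hy
      calc ‖m₂ y • ∫ x, k (x, y) * f x ∂μ‖ₑ
          = ENNReal.ofReal (m₂ y) * ‖∫ x, k (x, y) * f x ∂μ‖ₑ := by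
            rw [enorm_smul, Real.enorm_of_nonneg (hm₂pos y).le]
        _ ≤ ENNReal.ofReal (m₂ y) * (eLpNorm (fun x => (m₁ x)⁻¹ • k (x, y)) q μ
              * eLpNorm (fun x => m₁ x • f x) p μ) := by
            gcongr
            refine (enorm_integral_le_lintegral_enorm _).trans ?_
            rw [← eLpNorm_one_eq_lintegral_enorm]
            exact hholder y
        _ ≤ C * eLpNorm (fun x => m₁ x • f x) p μ := by
            rw [← mul_assoc]
            gcongr
  have lower : ∀ C' : ℝ≥0∞,
      (∀ f : X → ℂ, AEStronglyMeasurable f μ →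
        eLpNorm (fun x => m₁ x • f x) p μ < ⊤ →
        (∀ᵐ y ∂ν, Integrable (fun x => k (x, y) * f x) μ) ∧
        eLpNorm (fun y => m₂ y • ∫ x, k (x, y) * f x ∂μ) ⊤ ν
          ≤ C' * eLpNorm (fun x => m₁ x • f x) p μ) →
      C ≤ C' := by
    intro C' H
    set K : X × Y → ℂ := fun z => m₂ z.2 • (m₁ z.1)⁻¹ • k z with hKdef
    have hK : Measurable K :=
      (hm₂.comp measurable_snd).smul ((hm₁.comp measurable_fst).inv.smul hk)
    have hA : ∀ j, MeasurableSet (spanningSets μ j) := measurableSet_spanningSets μ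
    have hrestrict : ∀ j, ∀ᵐ y ∂ν,
        eLpNorm (fun x => K (x, y)) q (μ.restrict (spanningSets μ j)) ≤ C' := by
      intro j
      have : IsFiniteMeasure (μ.restrict (spanningSets μ j)) :=
        isFiniteMeasure_restrict.2 (measure_spanningSets_lt_top μ j).ne
      refine ae_eLpNorm_section_le (p := p) hK fun f hf ⟨R, hR⟩ => ?_
      set F : X → ℂ := (spanningSets μ j).indicator fun x => (m₁ x)⁻¹ • f x with hF
      have hFm : Measurable F := (hm₁.inv.smul hf).indicator (hA j)
      have hFp : eLpNorm (fun x => m₁ x • F x) p μ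
          = eLpNorm f p (μ.restrict (spanningSets μ j)) := by
        rw [← eLpNorm_indicator_eq_eLpNorm_restrict (hA j)]
        congr 1 with x
        by_cases hx : x ∈ spanningSets μ j
        · simp [hF, hx, (hm₁pos x).ne']
        · simp [hF, hx]
      have hfin : eLpNorm f p (μ.restrict (spanningSets μ j)) < ⊤ :=
        (MemLp.of_bound hf.aestronglyMeasurable R (ae_of_all _ hR)).2
      obtain ⟨hint, hnorm⟩ := H F hFm.aestronglyMeasurable (hFp ▸ hfin)
      rw [hFp] at hnorm
      have hkF : ∀ y, (fun x => m₂ y • (k (x, y) * F x))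
          = (spanningSets μ j).indicator fun x => K (x, y) * f x := fun y => by
        ext x
        by_cases hx : x ∈ spanningSets μ j
        · simp only [hF, hKdef, hx, Set.indicator_of_mem, Complex.real_smul]
          ring
        · simp [hF, hx]
      refine ⟨?_, ?_⟩
      · filter_upwards [hint] with y hy
        rw [← IntegrableOn, ← integrable_indicator_iff (hA j), ← hkF]
        exact hy.smul (m₂ y)
      · filter_upwards [ae_le_eLpNormEssSup (f := fun y => m₂ y • ∫ x, k (x, y) * F x ∂μ)
          (μ := ν)] with y hy
        rw [← integral_indicator (hA j), ← hkF, integral_smul]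
        exact hy.trans hnorm
    rw [hC]
    refine essSup_le_of_ae_le _ ?_
    filter_upwards [ae_all_iff.2 hrestrict] with y hy
    have hKy : Measurable fun x => K (x, y) := hK.comp measurable_prodMk_right
    have hfull : eLpNorm (fun x => K (x, y)) q μ ≤ C' := by
      refine Lp.eLpNorm_le_of_ae_tendsto (u := atTop)
        (f := fun j => (spanningSets μ j).indicator fun x => K (x, y))
        (Eventually.of_forall fun j => ?_)
        (fun j => (hKy.indicator (hA j)).aestronglyMeasurable) (ae_of_all _ fun x => ?_)
      · rw [eLpNorm_indicator_eq_eLpNorm_restrict (hA j)]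
        exact hy j
      · refine tendsto_const_nhds.congr' ?_
        filter_upwards [eventually_ge_atTop (spanningSetsIndex μ x)] with j hj
        exact (Set.indicator_of_mem (mem_spanningSets_of_index_le μ x hj)
          fun x => K (x, y)).symm
    calc ENNReal.ofReal (m₂ y) * eLpNorm (fun x => (m₁ x)⁻¹ • k (x, y)) q μ
        = eLpNorm (fun x => K (x, y)) q μ := by
          rw [← Real.enorm_of_nonneg (hm₂pos y).le]
          exact (eLpNorm_const_smul (m₂ y) _ q μ).symm
      _ ≤ C' := hfull
  exact ⟨upper, lower, fun ⟨C', hC', H⟩ => (lower C' H).trans_lt hC',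
    fun hCtop => ⟨C, hCtop, upper hCtop⟩⟩
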